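/- arXiv:1210.4213 — 3 statements merged into one kernel-verified Lean document; each statement's English description precedes it below -/
import Mathlib

section
/- Let D be a connected simple graph, let J be a subset of the vertices of D, and let f : J → ℤ. There exists a function F defined on all vertices of D with integer values such that F agrees with f on J and F is gradually varied (i.e., for every pair of adjacent vertices a, b of D, |F(a) − F(b)| ≤ 1) if and only if for all x, y ∈ J, |f(x) − f(y)| ≤ d(x, y), where d denotes the graph distance in D. -/
namespace SimpleGraph

variable {V : Type*} {D : SimpleGraph V}

/-- A function changing by at most one along edges changes by at most the length along a walk. -/
theorem Walk.abs_sub_le_length {F : V → ℤ} (hF : ∀ a b : V, D.Adj a b → |F a - F b| ≤ 1)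
    {u v : V} (p : D.Walk u v) : |F u - F v| ≤ p.length := by
  induction p with
  | nil => simp
  | @cons u v w h p ih =>
    have h₁ := abs_sub_le (F u) (F v) (F w)
    have h₂ := hF _ _ h
    rw [Walk.length_cons]
    push_cast
    linarith

/-- The infimal convolution of `f` with the graph distance. -/
noncomputable def distExtension (D : SimpleGraph V) {J : Set V} (f : J → ℤ) (v : V) : ℤ :=
  ⨅ x : J, (f x + D.dist x v)

variable {J : Set V} {f : J → ℤ}

theorem sub_dist_le_add_dist (hconn : D.Connected)
    (hf : ∀ x y : J, |f x - f y| ≤ (D.dist (x : V) (y : V) : ℤ)) (x y : J) (v : V) :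
    f y - D.dist y v ≤ f x + D.dist x v := by
  have h₁ := (abs_le.1 (hf y x)).2
  have h₂ : D.dist (y : V) x ≤ D.dist y v + D.dist v x := hconn.dist_triangle
  rw [D.dist_comm (u := v)] at h₂
  omega

theorem bddBelow_range_add_dist (hconn : D.Connected)
    (hf : ∀ x y : J, |f x - f y| ≤ (D.dist (x : V) (y : V) : ℤ)) (v : V) :
    BddBelow (Set.range fun x : J => f x + (D.dist x v : ℤ)) := by
  rcases isEmpty_or_nonempty J with _ | ⟨⟨y⟩⟩
  · simp
  · exact ⟨f y - D.dist y v, Set.forall_mem_range.2 fun x => sub_dist_le_add_dist hconn hf x y v⟩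

theorem distExtension_apply (hconn : D.Connected)
    (hf : ∀ x y : J, |f x - f y| ≤ (D.dist (x : V) (y : V) : ℤ)) (x : J) :
    D.distExtension f x = f x := by
  have : Nonempty J := ⟨x⟩
  apply le_antisymm
  · simpa [distExtension] using ciInf_le (bddBelow_range_add_dist hconn hf (x : V)) x
  · exact le_ciInf fun y => by simpa using sub_dist_le_add_dist hconn hf y x x

theorem distExtension_le_add_one (hconn : D.Connected)
    (hf : ∀ x y : J, |f x - f y| ≤ (D.dist (x : V) (y : V) : ℤ)) {a b : V} (hab : D.Adj a b) :
    D.distExtension f a ≤ D.distExtension f b + 1 := by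
  rcases isEmpty_or_nonempty J with _ | _
  · simp [distExtension, iInf_of_isEmpty]
  · rw [← sub_le_iff_le_add]
    refine le_ciInf fun x => ?_
    have h₁ : D.distExtension f a ≤ f x + D.dist x a :=
      ciInf_le (bddBelow_range_add_dist hconn hf a) x
    have h₂ : D.dist (x : V) a ≤ D.dist x b + D.dist b a := hconn.dist_triangle
    rw [dist_eq_one_iff_adj.2 hab.symm] at h₂
    omega

end SimpleGraph

/-- Theorem 1 (Chen, 1989): existence of a gradually varied extension iff the
distance condition holds on the sample set `J`. -/
theorem gradually_varied_extension_iff {V : Type*} (D : SimpleGraph V)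
    (hconn : D.Connected) (J : Set V) (f : J → ℤ) :
    (∃ F : V → ℤ, (∀ x : J, F x = f x) ∧
        ∀ a b : V, D.Adj a b → |F a - F b| ≤ 1) ↔
    (∀ x y : J, |f x - f y| ≤ (D.dist (x : V) (y : V) : ℤ)) := by
  constructor
  · rintro ⟨F, hFf, hF⟩ x y
    obtain ⟨p, hp⟩ := hconn.exists_walk_length_eq_dist (x : V) y
    rw [← hFf, ← hFf, ← hp]
    exact p.abs_sub_le_length hF
  · intro hf
    refine ⟨D.distExtension f, SimpleGraph.distExtension_apply hconn hf, fun a b hab => ?_⟩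
    have h₁ := SimpleGraph.distExtension_le_add_one hconn hf hab
    have h₂ := SimpleGraph.distExtension_le_add_one hconn hf hab.symm
    exact abs_le.2 ⟨by linarith, by linarith⟩
end

section
/- Let D be a connected simple graph, J a subset of the vertices of D, and f : J → ℤ a function satisfying |f(x) − f(y)| ≤ d(x, y) for all x, y ∈ J, where d is the graph distance in D. Then there exists a gradually varied function F on all vertices of D (i.e., |F(a) − F(b)| ≤ 1 for all adjacent a, b) with F(x) = f(x) for all x ∈ J. -/
/-- Sufficiency direction of Theorem 1 (Chen, 1989): the distance condition on
`J` guarantees a gradually varied extension of `f` to all of `D`. -/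
theorem gradually_varied_extension_exists {V : Type*} (D : SimpleGraph V)
    (hconn : D.Connected) (J : Set V) (f : J → ℤ)
    (hf : ∀ x y : J, |f x - f y| ≤ (D.dist (x : V) (y : V) : ℤ)) :
    ∃ F : V → ℤ, (∀ x : J, F x = f x) ∧
      ∀ a b : V, D.Adj a b → |F a - F b| ≤ 1 := by
  rcases isEmpty_or_nonempty J with hJ | ⟨⟨x₀⟩⟩
  · exact ⟨fun _ => 0, fun x => hJ.elim x, by simp⟩
  have : Nonempty J := ⟨x₀⟩
  have tri (u v w : V) : (D.dist u w : ℤ) ≤ D.dist u v + D.dist v w :=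
    mod_cast hconn.dist_triangle
  have bdd (v : V) : BddBelow (Set.range fun x : J => f x + (D.dist (x : V) v : ℤ)) := by
    refine ⟨f x₀ - D.dist (x₀ : V) v, ?_⟩
    rintro _ ⟨x, rfl⟩
    have h := (abs_le.mp (hf x₀ x)).2
    have ht := tri x₀ v x
    rw [D.dist_comm (u := v)] at ht
    dsimp only
    linarith
  have step (a b : V) (hab : D.Adj a b) :
      (⨅ x : J, f x + (D.dist (x : V) a : ℤ)) - 1 ≤ ⨅ x : J, f x + (D.dist (x : V) b : ℤ) := by
    refine le_ciInf fun x => ?_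
    have h := ciInf_le (bdd a) x
    have ht := tri x b a
    rw [SimpleGraph.dist_eq_one_iff_adj.mpr hab.symm] at ht
    push_cast at ht
    linarith
  refine ⟨fun v => ⨅ x : J, f x + (D.dist (x : V) v : ℤ), fun y => le_antisymm ?_ ?_,
    fun a b hab => abs_le.mpr ⟨?_, ?_⟩⟩
  · simpa using ciInf_le (bdd y) y
  · refine le_ciInf fun x => ?_
    linarith [(abs_le.mp (hf x y)).1]
  · linarith [step b a hab.symm]
  · linarith [step a b hab]
end

section
/- Let D be a finite connected simple graph, J a nonempty subset of the vertices of D, and f : J → ℤ a function satisfying |f(x) − f(y)| ≤ d(x, y) for all x, y ∈ J, where d is the graph distance in D. Define F(v) = min over y ∈ J of (f(y) + d(v, y)) for every vertex v of D. Then F is a gradually varied extension of f: F(x) = f(x) for all x ∈ J, and |F(a) − F(b)| ≤ 1 for every pair of adjacent vertices a, b of D. -/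
/-- The explicit minimum construction `F v = min_{y ∈ J} (f y + d(v, y))` is a
gradually varied extension of `f`. -/
theorem min_construction_is_gradually_varied_extension {V : Type*} [Fintype V]
    (D : SimpleGraph V) (hconn : D.Connected)
    (J : Finset V) (hJ : J.Nonempty) (f : J → ℤ)
    (hf : ∀ x y : J, |f x - f y| ≤ (D.dist (x : V) (y : V) : ℤ))
    (F : V → ℤ)
    (hFdef : ∀ v : V,
      F v = J.attach.inf' (Finset.attach_nonempty_iff.mpr hJ)
        (fun y => f y + (D.dist v (y : V) : ℤ))) :
    (∀ x : J, F x = f x) ∧ ∀ a b : V, D.Adj a b → |F a - F b| ≤ 1 := by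
  have step : ∀ a b : V, D.Adj a b → F a ≤ F b + 1 := by
    intro a b hab
    obtain ⟨y, hy, hmin⟩ := J.attach.exists_mem_eq_inf' (Finset.attach_nonempty_iff.mpr hJ)
      (fun y => f y + (D.dist b (y : V) : ℤ))
    have hle := Finset.inf'_le (fun y : J => f y + (D.dist a (y : V) : ℤ)) hy
    have htri : D.dist a y ≤ D.dist a b + D.dist b y := hconn.dist_triangle
    have hone : D.dist a b = 1 := SimpleGraph.dist_eq_one_iff_adj.mpr hab
    rw [hFdef a, hFdef b, hmin]
    omega
  refine ⟨fun x => ?_, fun a b hab => ?_⟩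
  · rw [hFdef]
    apply le_antisymm
    · exact (Finset.inf'_le (fun y : J => f y + (D.dist (x : V) (y : V) : ℤ))
        (Finset.mem_attach J x)).trans (by simp)
    · refine Finset.le_inf' _ _ fun y _ => ?_
      linarith [(abs_le.mp (hf x y)).2]
  · rw [abs_le]
    constructor <;> linarith [step a b hab, step b a hab.symm]
end
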